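/- For every δ > 0 there exists a countable partition P of ℝ^d (with chosen centers) such that, for all μ ∈ P(ℝ^d) with ∫‖x‖^{p+1} dμ(x) ≤ 1 and any rounding map r_P onto the centers, one has both E[ ‖(r_P)♯μ̂_n − (r_P)♯μ‖_TV ] ≤ C √( δ^{−d} / n ) and (∫ ‖r_P(x) − x‖^p dμ(x))^{1/p} ≤ C δ, for an absolute constant C. -/

import Mathlib

open MeasureTheory ProbabilityTheory Set
open scoped ENNReal NNReal

noncomputable section

abbrev Rd (d : ℕ) : Type := EuclideanSpace ℝ (Fin d)

/-- `π` is a coupling of `μ` and `ν`. -/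
def IsCoupling {d : ℕ} (π : Measure (Rd d × Rd d)) (μ ν : Measure (Rd d)) : Prop :=
  π.map Prod.fst = μ ∧ π.map Prod.snd = ν

/-- The `p`-Wasserstein distance between `μ` and `ν`. -/
noncomputable def Wp {d : ℕ} (p : ℝ) (μ ν : Measure (Rd d)) : ℝ :=
  sInf { c : ℝ | ∃ π : Measure (Rd d × Rd d), IsCoupling π μ ν ∧
    c = (∫ z, ‖z.1 - z.2‖ ^ p ∂π) ^ (1 / p) }

/-- The transport cost `(∫∫ ‖x-y‖^p dκ_x(y) dμ(x))^{1/p}` of a kernel. -/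
noncomputable def kernelCost {d : ℕ} (p : ℝ) (κ : Kernel (Rd d) (Rd d))
    (μ : Measure (Rd d)) : ℝ :=
  (∫ x, ∫ y, ‖x - y‖ ^ p ∂(κ x) ∂μ) ^ (1 / p)

/-- Pushforward of `μ` by the kernel `κ`. -/
noncomputable def kpush {d : ℕ} (κ : Kernel (Rd d) (Rd d)) (μ : Measure (Rd d)) :
    Measure (Rd d) :=
  μ.bind fun x => κ x

/-- The transportation error `E_p(κ; μ, ν)`: optimality gap plus feasibility gap. -/
noncomputable def Ep {d : ℕ} (p : ℝ) (κ : Kernel (Rd d) (Rd d)) (μ ν : Measure (Rd d)) : ℝ :=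
  max (kernelCost p κ μ - Wp p μ ν) 0 + Wp p (kpush κ μ) ν

/-- Total variation distance between measures. -/
noncomputable def tvDist {α : Type*} [MeasurableSpace α] (μ ν : Measure α) : ℝ :=
  sSup { r : ℝ | ∃ A : Set α, MeasurableSet A ∧ r = |(μ A).toReal - (ν A).toReal| }

/-- Finite `p`-th moment. -/
def HasFiniteMoment {d : ℕ} (p : ℝ) (μ : Measure (Rd d)) : Prop :=
  Integrable (fun x => ‖x‖ ^ p) μ


/-- Empirical measure of `n` points. -/
noncomputable def empMeasure {d n : ℕ} (xs : Fin n → Rd d) : Measure (Rd d) :=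
  (n : ℝ≥0∞)⁻¹ • ∑ i : Fin n, Measure.dirac (xs i)

open Module in
/-- An `r`-separated set in the closed ball of radius `R` has at most `(1 + 2R/r) ^ dim` points. -/
theorem card_le_of_separated_of_norm_le {E : Type*} [NormedAddCommGroup E] [NormedSpace ℝ E]
    [FiniteDimensional ℝ E] {R r : ℝ} (hR : 0 ≤ R) (hr : 0 < r) (s : Finset E)
    (hs : ∀ c ∈ s, ‖c‖ ≤ R) (h : ∀ c ∈ s, ∀ c' ∈ s, c ≠ c' → r < dist c c') :
    (s.card : ℝ) ≤ (1 + 2 * R / r) ^ finrank ℝ E := by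
  borelize E
  let μ : Measure E := Measure.addHaar
  have hρ : 0 < R + r / 2 := by positivity
  have D : Set.PairwiseDisjoint (s : Set E) fun c => Metric.ball c (r / 2) := by
    intro c hc c' hc' hcc'
    apply Metric.ball_disjoint_ball
    have := h c hc c' hc' hcc'
    linarith
  have hsub : (⋃ c ∈ s, Metric.ball c (r / 2)) ⊆ Metric.ball 0 (R + r / 2) := by
    refine iUnion₂_subset fun x hx => Metric.ball_subset_ball' ?_
    rw [dist_zero_right]
    linarith [hs x hx]
  have I : (s.card : ℝ≥0∞) * ENNReal.ofReal ((r / 2) ^ finrank ℝ E) * μ (Metric.ball 0 1) ≤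
      ENNReal.ofReal ((R + r / 2) ^ finrank ℝ E) * μ (Metric.ball 0 1) :=
    calc
      _ = μ (⋃ c ∈ s, Metric.ball c (r / 2)) := by
        rw [measure_biUnion_finset D fun c _ => measurableSet_ball]
        simp only [μ.addHaar_ball_of_pos _ (half_pos hr)]
        simp only [Finset.sum_const, nsmul_eq_mul, mul_assoc]
      _ ≤ μ (Metric.ball (0 : E) (R + r / 2)) := measure_mono hsub
      _ = _ := by rw [μ.addHaar_ball_of_pos _ hρ]
  have J := (ENNReal.mul_le_mul_iff_left (Metric.measure_ball_pos μ _ zero_lt_one).ne'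
    measure_ball_lt_top.ne).1 I
  have K := ENNReal.toReal_le_of_le_ofReal (by positivity) J
  rw [ENNReal.toReal_mul, ENNReal.toReal_natCast, ENNReal.toReal_ofReal (by positivity)] at K
  have e : 1 + 2 * R / r = (R + r / 2) / (r / 2) := by field_simp; ring
  rw [e, div_pow, le_div_iff₀ (by positivity)]
  exact K

open Module in
/-- A bounded set contains a finite net that is `r`-separated and `r`-dense in it. -/
theorem exists_finset_separated_net {E : Type*} [NormedAddCommGroup E] [NormedSpace ℝ E]
    [FiniteDimensional ℝ E] {R r : ℝ} (hR : 0 ≤ R) (hr : 0 < r) (A : Set E)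
    (hA : ∀ c ∈ A, ‖c‖ ≤ R) :
    ∃ T : Finset E, (∀ c ∈ T, c ∈ A) ∧ (∀ c ∈ T, ∀ c' ∈ T, c ≠ c' → r < dist c c') ∧
      (∀ x ∈ A, ∃ c ∈ T, dist x c ≤ r) ∧ (T.card : ℝ) ≤ (1 + 2 * R / r) ^ finrank ℝ E := by
  classical
  let P : Finset E → Prop := fun T =>
    (∀ c ∈ T, c ∈ A) ∧ ∀ c ∈ T, ∀ c' ∈ T, c ≠ c' → r < dist c c'
  have hb : ∀ T, P T → (T.card : ℝ) ≤ (1 + 2 * R / r) ^ finrank ℝ E := fun T hT =>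
    card_le_of_separated_of_norm_le hR hr T (fun c hc => hA c (hT.1 c hc)) hT.2
  have hne : {m : ℕ | ∃ T, P T ∧ T.card = m}.Nonempty := ⟨0, ∅, by simp [P], rfl⟩
  have hbd : BddAbove {m : ℕ | ∃ T, P T ∧ T.card = m} := by
    refine ⟨⌊(1 + 2 * R / r) ^ finrank ℝ E⌋₊, ?_⟩
    rintro _ ⟨T, hT, rfl⟩
    exact Nat.le_floor (hb T hT)
  obtain ⟨T, hT, hcard⟩ := Nat.sSup_mem hne hbd
  refine ⟨T, hT.1, hT.2, fun x hx => ?_, hb T hT⟩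
  by_contra! hfar
  have hxT : x ∉ T := fun hxT => by
    have := hfar x hxT
    rw [dist_self] at this
    linarith
  have hP : P (insert x T) := by
    refine ⟨by simpa [hx] using hT.1, fun c hc c' hc' hcc' => ?_⟩
    rcases Finset.mem_insert.1 hc with h | h <;> rcases Finset.mem_insert.1 hc' with h' | h'
    · exact absurd (h.trans h'.symm) hcc'
    · exact h ▸ hfar c' h'
    · rw [dist_comm]
      exact h' ▸ hfar c h
    · exact hT.2 c h c' h' hcc'
  have := le_csSup hbd ⟨_, hP, rfl⟩
  rw [Finset.card_insert_of_notMem hxT] at this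
  omega

/-- Nets of the level sets of `k` give a measurable idempotent rounding map onto their union. -/
theorem exists_rounding {E : Type*} [PseudoMetricSpace E] [MeasurableSpace E]
    [OpensMeasurableSpace E] [Nonempty E] {k : E → ℕ} (hk : Measurable k) (T : ℕ → Finset E)
    (r : ℕ → ℝ) (hT : ∀ j, ∀ c ∈ T j, k c = j)
    (hsep : ∀ j, ∀ c ∈ T j, ∀ c' ∈ T j, c ≠ c' → r j < dist c c')
    (hcov : ∀ x, ∃ c ∈ T (k x), dist x c ≤ r (k x)) :
    ∃ f : E → E, Measurable f ∧ (∀ x, f (f x) = f x) ∧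
      ∀ x, f x ∈ T (k x) ∧ dist x (f x) ≤ r (k x) := by
  classical
  have hS : (⋃ j, (T j : Set E)).Countable := countable_iUnion fun j => (T j).countable_toSet
  have hSne : (⋃ j, (T j : Set E)).Nonempty := by
    obtain ⟨c, hc, -⟩ := hcov (Classical.arbitrary E)
    exact ⟨c, mem_iUnion.2 ⟨_, hc⟩⟩
  obtain ⟨e, he⟩ := hS.exists_eq_range hSne
  have heT : ∀ i, e i ∈ T (k (e i)) := fun i => by
    obtain ⟨j, hj⟩ := mem_iUnion.1 (he ▸ mem_range_self i : e i ∈ ⋃ j, (T j : Set E))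
    rwa [hT j _ hj]
  let p : ℕ → E → Prop := fun i x => k x = k (e i) ∧ dist x (e i) ≤ r (k (e i))
  have hex : ∀ x, ∃ i, p i x := fun x => by
    obtain ⟨c, hc, hd⟩ := hcov x
    obtain ⟨i, rfl⟩ := (he ▸ mem_iUnion.2 ⟨_, hc⟩ : c ∈ range e)
    have := hT _ _ hc
    exact ⟨i, this.symm, by rwa [this]⟩
  have hspec : ∀ x, p (Nat.find (hex x)) x := fun x => Nat.find_spec (hex x)
  have huniq : ∀ i j, p i (e j) → e i = e j := fun i j hij => by
    by_contra hne
    have h1 : e j ∈ T (k (e i)) := hij.1 ▸ heT j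
    have := hsep _ _ h1 _ (heT i) (Ne.symm hne)
    linarith [hij.2]
  refine ⟨fun x => e (Nat.find (hex x)), ?_, fun x => huniq _ _ (hspec _), fun x => ?_⟩
  · refine Measurable.find (f := fun i _ => e i) (fun i => measurable_const) (fun i => ?_) hex
    exact (hk (measurableSet_singleton _)).inter Metric.isClosed_closedBall.measurableSet
  · obtain ⟨h1, h2⟩ := hspec x
    exact ⟨by rw [h1]; exact heT _, by rw [h1]; exact h2⟩

theorem tvDist_nonneg {α : Type*} [MeasurableSpace α] (μ ν : Measure α) : 0 ≤ tvDist μ ν := by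
  apply Real.sSup_nonneg
  rintro _ ⟨A, -, rfl⟩
  exact abs_nonneg _

theorem tvDist_self {α : Type*} [MeasurableSpace α] (μ : Measure α) : tvDist μ μ = 0 := by
  refine le_antisymm (Real.sSup_nonpos ?_) (tvDist_nonneg μ μ)
  rintro _ ⟨A, -, rfl⟩
  simp

theorem measure_preimage_le_add_tsum {E F : Type*} [MeasurableSpace E] [MeasurableSpace F]
    [MeasurableSingletonClass F] (α β : Measure E) [IsFiniteMeasure α] [IsFiniteMeasure β]
    {f : E → F} (hf : Measurable f) {S : Set F} (hS : S.Countable) (hfS : ∀ x, f x ∈ S)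
    (A : Set F) :
    α (f ⁻¹' A) ≤ β (f ⁻¹' A) +
      ∑' c : S, ENNReal.ofReal |α.real (f ⁻¹' {(c : F)}) - β.real (f ⁻¹' {(c : F)})| := by
  have hA : f ⁻¹' A = f ⁻¹' (A ∩ S) := by
    ext x; simp [hfS]
  have hc : (A ∩ S).Countable := hS.mono inter_subset_right
  have hm : ∀ c ∈ A ∩ S, MeasurableSet (f ⁻¹' {c}) := fun c _ => hf (measurableSet_singleton c)
  rw [hA, ← tsum_measure_preimage_singleton hc hm, ← tsum_measure_preimage_singleton hc hm]
  calc ∑' c : ↥(A ∩ S), α (f ⁻¹' {(c : F)})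
      ≤ ∑' c : ↥(A ∩ S), (β (f ⁻¹' {(c : F)}) +
          ENNReal.ofReal |α.real (f ⁻¹' {(c : F)}) - β.real (f ⁻¹' {(c : F)})|) := by
        refine ENNReal.tsum_le_tsum fun c => ?_
        rw [← ofReal_measureReal (μ := α), ← ofReal_measureReal (μ := β),
          ← ENNReal.ofReal_add measureReal_nonneg (abs_nonneg _)]
        refine ENNReal.ofReal_le_ofReal ?_
        linarith [le_abs_self (α.real (f ⁻¹' {(c : F)}) - β.real (f ⁻¹' {(c : F)}))]
    _ ≤ _ := by
        rw [ENNReal.tsum_add]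
        gcongr
        exact ENNReal.tsum_mono_subtype
          (fun c => ENNReal.ofReal |α.real (f ⁻¹' {c}) - β.real (f ⁻¹' {c})|) inter_subset_right

/-- The total variation distance of two pushforwards under a map with values in `⋃ j, T j` is
at most the `ℓ¹` distance of the masses of the fibers. -/
theorem ofReal_tvDist_map_le {E F : Type*} [MeasurableSpace E] [MeasurableSpace F]
    [MeasurableSingletonClass F] (α β : Measure E) [IsFiniteMeasure α] [IsFiniteMeasure β]
    {f : E → F} (hf : Measurable f) (T : ℕ → Finset F) (hfT : ∀ x, ∃ j, f x ∈ T j) :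
    ENNReal.ofReal (tvDist (α.map f) (β.map f)) ≤
      ∑' j, ∑ c ∈ T j, ENNReal.ofReal |α.real (f ⁻¹' {c}) - β.real (f ⁻¹' {c})| := by
  set S : Set F := ⋃ j, (T j : Set F)
  have hS : S.Countable := countable_iUnion fun j => (T j).countable_toSet
  have hfS : ∀ x, f x ∈ S := fun x => mem_iUnion.2 (hfT x)
  set D : F → ℝ≥0∞ := fun c => ENNReal.ofReal |α.real (f ⁻¹' {c}) - β.real (f ⁻¹' {c})| with hD
  have hle : ∑' c : S, D c ≤ ∑' j, ∑ c ∈ T j, D c := by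
    refine (ENNReal.tsum_iUnion_le_tsum D fun j => (T j : Set F)).trans_eq ?_
    congr 1 with j
    exact Finset.tsum_subtype (T j) D
  refine le_trans ?_ hle
  rcases eq_or_ne (∑' c : S, D c) ∞ with h | h
  · simp [h]
  refine ENNReal.ofReal_le_of_le_toReal (Real.sSup_le ?_ ENNReal.toReal_nonneg)
  rintro _ ⟨A, hA, rfl⟩
  rw [Measure.map_apply hf hA, Measure.map_apply hf hA, abs_sub_le_iff]
  have key := measure_preimage_le_add_tsum α β hf hS hfS A
  have key' := measure_preimage_le_add_tsum β α hf hS hfS A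
  simp_rw [abs_sub_comm (β.real _)] at key'
  constructor
  · have := ENNReal.toReal_mono (by finiteness) key
    rw [ENNReal.toReal_add (by finiteness) h] at this
    linarith
  · have := ENNReal.toReal_mono (by finiteness) key'
    rw [ENNReal.toReal_add (by finiteness) h] at this
    linarith

instance isFiniteMeasure_empMeasure {d n : ℕ} [NeZero n] (xs : Fin n → Rd d) :
    IsFiniteMeasure (empMeasure xs) := by
  constructor
  have : (n : ℝ≥0∞)⁻¹ ≠ ∞ := by simp [NeZero.ne n]
  simp only [empMeasure, Measure.smul_apply, smul_eq_mul, Measure.finsetSum_apply, measure_univ]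
  exact ENNReal.mul_lt_top this.lt_top (by simp)

theorem measureReal_empMeasure {d n : ℕ} (xs : Fin n → Rd d) {A : Set (Rd d)}
    (hA : MeasurableSet A) :
    (empMeasure xs).real A = (n : ℝ)⁻¹ * ∑ i, A.indicator (1 : Rd d → ℝ) (xs i) := by
  simp only [empMeasure, measureReal_def, Measure.smul_apply, smul_eq_mul,
    Measure.finsetSum_apply, Measure.dirac_apply' _ hA, ENNReal.toReal_mul, ENNReal.toReal_inv,
    ENNReal.toReal_natCast]
  congr 1
  rw [ENNReal.toReal_sum fun i _ => by by_cases h : xs i ∈ A <;> simp [h]]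
  refine Finset.sum_congr rfl fun i _ => ?_
  by_cases h : xs i ∈ A <;> simp [h]

/-- The mean deviation of the empirical mass of a set is at most `√(μ(A) / n)`. -/
theorem lintegral_abs_empMeasure_sub_le {d n : ℕ} (hn : 1 ≤ n) (μ : Measure (Rd d))
    [IsProbabilityMeasure μ] {A : Set (Rd d)} (hA : MeasurableSet A) :
    ∫⁻ xs, ENNReal.ofReal |(empMeasure xs).real A - μ.real A| ∂(Measure.pi fun _ : Fin n => μ) ≤
      ENNReal.ofReal (√(μ.real A / n)) := by
  have hn0 : (0 : ℝ) < n := by exact_mod_cast hn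
  set g : Rd d → ℝ := A.indicator 1 with hg
  have hgm : MemLp g 2 μ := memLp_indicator_const 2 hA (1 : ℝ) (Or.inr (by finiteness))
  set P := Measure.pi fun _ : Fin n => μ with hP
  set X : (Fin n → Rd d) → ℝ := ∑ i, fun xs => g (xs i) with hX
  have hgi : ∀ i, MemLp (fun xs : Fin n → Rd d => g (xs i)) 2 P := fun i =>
    hgm.comp_measurePreserving (measurePreserving_eval (fun _ : Fin n => μ) i)
  have hXm : MemLp X 2 P := memLp_finsetSum' _ fun i _ => hgi i
  have hgint : ∫ x, g x ∂μ = μ.real A := by simp [hg, integral_indicator_one hA]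
  have hmean : P[X] = n * μ.real A := by
    simp only [hX, Finset.sum_apply]
    rw [integral_finsetSum _ fun i _ => (hgi i).integrable (by norm_num)]
    have : ∀ i : Fin n, ∫ xs, g (xs i) ∂P = μ.real A := fun i => by
      rw [← hgint]
      exact integral_comp_eval (μ := fun _ : Fin n => μ) hgm.aestronglyMeasurable
    simp [this]
  have hvar1 : Var[g; μ] ≤ μ.real A := by
    refine (variance_le_expectation_sq hgm.aestronglyMeasurable).trans_eq ?_
    rw [← hgint]
    congr 1 with x
    by_cases h : x ∈ A <;> simp [hg, h]
  have hvar : Var[X; P] ≤ n * μ.real A := by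
    rw [hX, hP, variance_sum_pi (X := fun _ => g) fun _ => hgm]
    simpa using mul_le_mul_of_nonneg_left hvar1 hn0.le
  set Y : (Fin n → Rd d) → ℝ := fun xs => |(empMeasure xs).real A - μ.real A| with hY
  have hYX : Y = fun xs => |(n : ℝ)⁻¹ * (X xs - P[X])| := by
    funext xs
    rw [hmean, mul_sub, inv_mul_cancel_left₀ hn0.ne']
    simp only [hY, measureReal_empMeasure xs hA, hX, Finset.sum_apply, hg]
  have hYm : MemLp Y 2 P := by
    rw [hYX]
    exact ((hXm.sub (memLp_const _)).const_mul _).norm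
  rw [← ofReal_integral_eq_lintegral_ofReal (hYm.integrable (by norm_num))
    (ae_of_all _ fun _ => abs_nonneg _)]
  refine ENNReal.ofReal_le_ofReal (Real.le_sqrt_of_sq_le ?_)
  have hsq : ∫ xs, Y xs ^ 2 ∂P ≤ μ.real A / n := by
    have : ∀ xs, Y xs ^ 2 = ((n : ℝ)⁻¹) ^ 2 * (X xs - P[X]) ^ 2 := fun xs => by
      rw [hYX, sq_abs, mul_pow]
    simp_rw [this]
    rw [integral_const_mul, ← variance_eq_integral hXm.aestronglyMeasurable.aemeasurable]
    calc _ ≤ ((n : ℝ)⁻¹) ^ 2 * (n * μ.real A) := by gcongr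
      _ = _ := by field_simp
  have h0 := variance_nonneg Y P
  rw [variance_eq_sub hYm] at h0
  refine le_trans ?_ hsq
  simpa using sub_nonneg.1 h0

theorem sum_sqrt_div_le_of_fibers {E : Type*} [MeasurableSpace E] [MeasurableSingletonClass E]
    (μ : Measure E) [IsFiniteMeasure μ] {f : E → E} (hf : Measurable f) {T : Finset E} {S : Set E}
    (hS : ∀ x, f x ∈ T → x ∈ S) (n : ℕ) :
    ∑ c ∈ T, √(μ.real (f ⁻¹' {c}) / n) ≤ √(T.card * (μ.real S / n)) := by
  refine Real.le_sqrt_of_sq_le (sq_sum_le_card_mul_sum_sq.trans ?_)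
  gcongr
  simp_rw [fun c => Real.sq_sqrt (show 0 ≤ μ.real (f ⁻¹' {c}) / n by positivity)]
  rw [← Finset.sum_div, ← measureReal_biUnion_finset]
  · gcongr
    · finiteness
    · refine iUnion₂_subset fun c hc x hx => hS x ?_
      rwa [show f x = c from hx]
  · intro c _ c' _ hcc'
    exact (disjoint_singleton.2 hcc').preimage f
  · exact fun c _ => hf (measurableSet_singleton c)

/-- If shell `j` has mass `O(4 ^ (-j))` and is rounded to at most `N` points, the expected total
variation error of the rounded empirical measure is `O(√(N / n))`. -/
theorem integral_tvDist_map_empMeasure_le {d n : ℕ} (hn : 1 ≤ n) (μ : Measure (Rd d))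
    [IsProbabilityMeasure μ] {k : Rd d → ℕ} {f : Rd d → Rd d} (hf : Measurable f)
    {T : ℕ → Finset (Rd d)} (hT : ∀ j, ∀ c ∈ T j, k c = j) (hfT : ∀ x, f x ∈ T (k x))
    {N B : ℝ} (hN : ∀ j, ((T j).card : ℝ) ≤ N) (hB : ∀ j, 4 ^ j * μ.real (k ⁻¹' {j}) ≤ B) :
    ∫ xs, tvDist ((empMeasure xs).map f) (μ.map f) ∂(Measure.pi fun _ : Fin n => μ) ≤
      2 * √(N * B / n) := by
  have : NeZero n := ⟨by omega⟩
  set P := Measure.pi fun _ : Fin n => μ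
  have hmeas : ∀ c, MeasurableSet (f ⁻¹' {c}) := fun c => hf (measurableSet_singleton c)
  have hcell : ∀ j, ∑ c ∈ T j, √(μ.real (f ⁻¹' {c}) / n) ≤ √(N * B / n) * (1 / 2) ^ j := by
    intro j
    refine (sum_sqrt_div_le_of_fibers μ hf (S := k ⁻¹' {j}) (fun x hx => ?_) n).trans ?_
    · exact (hT _ _ (hfT x)).symm.trans (hT _ _ hx)
    · have h4 : √((1 / 4 : ℝ) ^ j) = (1 / 2) ^ j := by
        rw [show (1 / 4 : ℝ) ^ j = ((1 / 2) ^ j) ^ 2 by rw [← pow_mul, mul_comm, pow_mul]; norm_num]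
        exact Real.sqrt_sq (by positivity)
      have hm : μ.real (k ⁻¹' {j}) ≤ B * (1 / 4) ^ j := by
        rw [one_div, inv_pow, ← div_eq_mul_inv, le_div_iff₀ (by positivity), mul_comm]
        exact hB j
      rw [← h4, ← Real.sqrt_mul' _ (by positivity)]
      apply Real.sqrt_le_sqrt
      calc _ ≤ N * (B * (1 / 4) ^ j / n) := by
            gcongr
            · exact (Nat.cast_nonneg _).trans (hN 0)
            · exact hN j
        _ = _ := by ring
  have hmono : ∫⁻ xs, ENNReal.ofReal ‖tvDist ((empMeasure xs).map f) (μ.map f)‖ ∂P ≤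
      ENNReal.ofReal (2 * √(N * B / n)) := by
    calc _ ≤ ∫⁻ xs, ∑' j, ∑ c ∈ T j,
            ENNReal.ofReal |(empMeasure xs).real (f ⁻¹' {c}) - μ.real (f ⁻¹' {c})| ∂P := by
          refine lintegral_mono fun xs => ?_
          rw [Real.norm_of_nonneg (tvDist_nonneg _ _)]
          exact ofReal_tvDist_map_le _ _ hf T fun x => ⟨_, hfT x⟩
      _ = ∑' j, ∑ c ∈ T j, ∫⁻ xs,
            ENNReal.ofReal |(empMeasure xs).real (f ⁻¹' {c}) - μ.real (f ⁻¹' {c})| ∂P := by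
          have hD : ∀ c, Measurable fun xs : Fin n → Rd d =>
              ENNReal.ofReal |(empMeasure xs).real (f ⁻¹' {c}) - μ.real (f ⁻¹' {c})| := by
            intro c
            simp_rw [measureReal_empMeasure _ (hmeas c)]
            have : Measurable ((f ⁻¹' {c}).indicator (1 : Rd d → ℝ)) :=
              measurable_one.indicator (hmeas c)
            fun_prop
          rw [lintegral_tsum fun j => (Finset.measurable_sum _ fun c _ => hD c).aemeasurable]
          congr 1 with j
          exact lintegral_finsetSum _ fun c _ => hD c
      _ ≤ ∑' j : ℕ, ENNReal.ofReal (√(N * B / n) * (1 / 2) ^ j) := by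
          refine ENNReal.tsum_le_tsum fun j => ?_
          refine le_trans (Finset.sum_le_sum fun c _ =>
            lintegral_abs_empMeasure_sub_le hn μ (hmeas c)) ?_
          rw [← ENNReal.ofReal_sum_of_nonneg fun c _ => Real.sqrt_nonneg _]
          exact ENNReal.ofReal_le_ofReal (hcell j)
      _ = _ := by
          rw [← ENNReal.ofReal_tsum_of_nonneg (fun j => by positivity)
            (summable_geometric_two.mul_left _), tsum_mul_left, tsum_geometric_two, mul_comm]
  exact (le_abs_self _).trans ((norm_integral_le_lintegral_norm _).trans
    (ENNReal.toReal_le_of_le_ofReal (by positivity) hmono))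

theorem norm_le_two_pow_clog {E : Type*} [NormedAddCommGroup E] (x : E) :
    ‖x‖ ≤ 2 ^ Nat.clog 2 ⌈‖x‖⌉₊ :=
  (Nat.le_ceil _).trans (by exact_mod_cast Nat.le_pow_clog one_lt_two _)

theorem two_pow_clog_le {E : Type*} [NormedAddCommGroup E] (x : E) :
    (2 : ℝ) ^ Nat.clog 2 ⌈‖x‖⌉₊ ≤ 2 * max 1 ‖x‖ := by
  rcases h : Nat.clog 2 ⌈‖x‖⌉₊ with _ | j
  · linarith [le_max_left 1 ‖x‖]
  · have h1 : 2 ^ j < ⌈‖x‖⌉₊ := (Nat.lt_clog_iff_pow_lt one_lt_two).1 (by omega)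
    have h2 := Nat.lt_ceil.1 h1
    push_cast at h2
    rw [pow_succ]
    linarith [le_max_right 1 ‖x‖]

theorem max_one_rpow_le {t q s : ℝ} (ht : 0 ≤ t) (hsq : s ≤ q) :
    max 1 t ^ s ≤ 1 + t ^ q := by
  rcases le_total t 1 with h | h
  · rw [max_eq_left h, Real.one_rpow]
    linarith [Real.rpow_nonneg ht q]
  · rw [max_eq_right h]
    linarith [Real.rpow_le_rpow_of_exponent_le h hsq]

/-- An error of linear growth has `L^p` size controlled by the `p + 1` moment. -/
theorem integral_rpow_le_of_le_mul_max {E : Type*} [NormedAddCommGroup E] [MeasurableSpace E]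
    {μ : Measure E} [IsProbabilityMeasure μ] {p a : ℝ} (hp : 1 ≤ p) (ha : 0 ≤ a)
    (hi : Integrable (fun x => ‖x‖ ^ (p + 1)) μ) (hm : ∫ x, ‖x‖ ^ (p + 1) ∂μ ≤ 1)
    {g : E → ℝ} (hg0 : ∀ x, 0 ≤ g x) (hg : ∀ x, g x ≤ a * max 1 ‖x‖) :
    (∫ x, g x ^ p ∂μ) ^ (1 / p) ≤ 2 * a := by
  have hp0 : 0 < p := by linarith
  have hint : ∫ x, g x ^ p ∂μ ≤ (2 * a) ^ p := by
    calc _ ≤ ∫ x, a ^ p * (1 + ‖x‖ ^ (p + 1)) ∂μ := by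
          refine integral_mono_of_nonneg (ae_of_all _ fun x => Real.rpow_nonneg (hg0 x) p)
            (((integrable_const 1).add hi).const_mul _) (ae_of_all _ fun x => ?_)
          calc g x ^ p ≤ (a * max 1 ‖x‖) ^ p := Real.rpow_le_rpow (hg0 x) (hg x) hp0.le
            _ = a ^ p * max 1 ‖x‖ ^ p := Real.mul_rpow ha (by positivity)
            _ ≤ a ^ p * (1 + ‖x‖ ^ (p + 1)) :=
              mul_le_mul_of_nonneg_left (max_one_rpow_le (norm_nonneg x) (by linarith))
                (Real.rpow_nonneg ha p)
      _ = a ^ p * (1 + ∫ x, ‖x‖ ^ (p + 1) ∂μ) := by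
          rw [integral_const_mul, integral_add (integrable_const 1) hi]
          simp
      _ ≤ a ^ p * 2 := by gcongr; linarith
      _ ≤ a ^ p * 2 ^ p := by
          refine mul_le_mul_of_nonneg_left ?_ (Real.rpow_nonneg ha p)
          simpa using Real.rpow_le_rpow_of_exponent_le one_le_two hp
      _ = _ := by rw [Real.mul_rpow two_pos.le ha, mul_comm]
  calc _ ≤ ((2 * a) ^ p) ^ (1 / p) :=
        Real.rpow_le_rpow (integral_nonneg fun x => Real.rpow_nonneg (hg0 x) p) hint (by positivity)
    _ = 2 * a := by rw [← Real.rpow_mul (by positivity), mul_one_div_cancel hp0.ne', Real.rpow_one]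

theorem four_pow_mul_measureReal_shell_le {E : Type*} [NormedAddCommGroup E] [MeasurableSpace E]
    {μ : Measure E} [IsProbabilityMeasure μ] {p : ℝ} (hp : 1 ≤ p)
    (hi : Integrable (fun x => ‖x‖ ^ (p + 1)) μ) (hm : ∫ x, ‖x‖ ^ (p + 1) ∂μ ≤ 1) (j : ℕ) :
    4 ^ j * μ.real ((fun x => Nat.clog 2 ⌈‖x‖⌉₊) ⁻¹' {j}) ≤ 8 := by
  have hsub : (fun x : E => Nat.clog 2 ⌈‖x‖⌉₊) ⁻¹' {j} ⊆
      {x | (4 : ℝ) ^ j ≤ 4 * (1 + ‖x‖ ^ (p + 1))} := by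
    rintro x rfl
    have h1 := two_pow_clog_le x
    have h2 := max_one_rpow_le (norm_nonneg x) (show (2 : ℝ) ≤ p + 1 by linarith)
    rw [Real.rpow_two] at h2
    calc (4 : ℝ) ^ Nat.clog 2 ⌈‖x‖⌉₊ = (2 ^ Nat.clog 2 ⌈‖x‖⌉₊) ^ 2 := by
          rw [← pow_mul, mul_comm, pow_mul]; norm_num
      _ ≤ (2 * max 1 ‖x‖) ^ 2 := by gcongr
      _ ≤ _ := by rw [mul_pow]; linarith
  have hI : Integrable (fun x => 4 * (1 + ‖x‖ ^ (p + 1))) μ :=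
    ((integrable_const 1).add hi).const_mul _
  calc _ ≤ 4 ^ j * μ.real {x | (4 : ℝ) ^ j ≤ 4 * (1 + ‖x‖ ^ (p + 1))} := by
        gcongr
        finiteness
    _ ≤ ∫ x, 4 * (1 + ‖x‖ ^ (p + 1)) ∂μ :=
        mul_meas_ge_le_integral_of_nonneg (ae_of_all _ fun x => by positivity) hI _
    _ = 4 * (1 + ∫ x, ‖x‖ ^ (p + 1) ∂μ) := by
        rw [integral_const_mul, integral_add (integrable_const 1) hi]
        simp
    _ ≤ 8 := by linarith

/-- Refined partition for heavy-tailed sources: for every `δ > 0` there is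
a countable partition of `ℝ^d` (encoded by its idempotent rounding map `rP` onto the chosen
centers, with cells the fibers of `rP`) such that, for every `μ` with
`∫‖x‖^{p+1} dμ ≤ 1`, both `E[‖(r_P)♯μ̂_n − (r_P)♯μ‖_TV] ≤ C √(δ^{−d}/n)` and
`(∫‖r_P(x) − x‖^p dμ)^{1/p} ≤ C δ` hold, with `C` an absolute constant. -/
theorem refined_partition_exists :
    ∃ C : ℝ, 0 < C ∧
      ∀ {d : ℕ}, 1 ≤ d → ∀ {p : ℝ}, 1 ≤ p →
      ∀ δ : ℝ, 0 < δ →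
      ∃ rP : Rd d → Rd d, Measurable rP ∧ (Set.range rP).Countable ∧
        (∀ x, rP (rP x) = rP x) ∧
        ∀ (μ : Measure (Rd d)), IsProbabilityMeasure μ →
          Integrable (fun x => ‖x‖ ^ (p + 1)) μ →
          (∫ x, ‖x‖ ^ (p + 1) ∂μ) ≤ 1 →
          (∀ (n : ℕ), 1 ≤ n →
            (∫ xs, tvDist ((empMeasure xs).map rP) (μ.map rP)
                ∂(Measure.pi fun _ : Fin n => μ)) ≤
              C * Real.sqrt (δ ^ (-(d : ℝ)) / n)) ∧
          (∫ x, ‖rP x - x‖ ^ p ∂μ) ^ (1 / p) ≤ C * δ := by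
  refine ⟨12, by norm_num, fun {d} hd {p} hp δ hδ => ?_⟩
  rcases lt_or_ge 1 (3 * δ) with hbig | hsmall
  · refine ⟨fun _ => 0, measurable_const, (finite_range_const (c := (0 : Rd d))).countable, fun _ => rfl,
      fun μ hμ hi hm => ⟨fun n hn => ?_, ?_⟩⟩
    · have hn0 : (n : ℝ≥0∞) ≠ 0 := by simp; omega
      have : ∀ xs : Fin n → Rd d,
          tvDist ((empMeasure xs).map fun _ => (0 : Rd d)) (μ.map fun _ => 0) = 0 := fun xs => by
        have h1 : empMeasure xs univ = 1 := by
          simp [empMeasure, ENNReal.inv_mul_cancel hn0]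
        rw [Measure.map_const, Measure.map_const, h1, measure_univ, tvDist_self]
      simp only [this, integral_zero]
      positivity
    · refine (integral_rpow_le_of_le_mul_max hp zero_le_one hi hm (fun _ => norm_nonneg _)
        fun x => ?_).trans (by linarith)
      simp
  · have h3 : 0 < 3 * δ := by positivity
    have hk : Measurable fun x : Rd d => Nat.clog 2 ⌈‖x‖⌉₊ :=
      (measurable_from_top (f := Nat.clog 2)).comp (Nat.measurable_ceil.comp measurable_norm)
    choose T hTA hTsep hTcov hTcard using fun j : ℕ =>
      exists_finset_separated_net (R := 2 ^ j) (r := 3 * δ * 2 ^ j) (by positivity) (by positivity)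
        ((fun x : Rd d => Nat.clog 2 ⌈‖x‖⌉₊) ⁻¹' {j})
        (by rintro x rfl; exact norm_le_two_pow_clog x)
    obtain ⟨f, hf, hff, hfT⟩ := exists_rounding hk T _ hTA hTsep fun x => hTcov _ x rfl
    have hN : ∀ j, ((T j).card : ℝ) ≤ δ ^ (-(d : ℝ)) := fun j => by
      refine (hTcard j).trans ?_
      rw [finrank_euclideanSpace_fin, Real.rpow_neg hδ.le, Real.rpow_natCast, ← inv_pow]
      gcongr
      rw [mul_div_mul_right _ _ (by positivity : (2 : ℝ) ^ j ≠ 0), inv_eq_one_div,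
        ← sub_nonneg]
      have : 1 / δ - (1 + 2 / (3 * δ)) = (1 - 3 * δ) / (3 * δ) := by field_simp; ring
      rw [this]
      exact div_nonneg (by linarith) h3.le
    refine ⟨f, hf, ?_, hff, fun μ hμ hi hm => ⟨fun n hn => ?_, ?_⟩⟩
    · refine (countable_iUnion fun j => (T j).countable_toSet).mono ?_
      rintro _ ⟨x, rfl⟩
      exact mem_iUnion.2 ⟨_, (hfT x).1⟩
    · refine (integral_tvDist_map_empMeasure_le hn μ hf hTA (fun x => (hfT x).1) hN
        (four_pow_mul_measureReal_shell_le hp hi hm)).trans ?_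
      have h8 : √(8 : ℝ) ≤ 6 := Real.sqrt_le_iff.2 (by norm_num)
      rw [mul_div_right_comm, Real.sqrt_mul' _ (by norm_num)]
      nlinarith [Real.sqrt_nonneg (δ ^ (-(d : ℝ)) / n)]
    · refine (integral_rpow_le_of_le_mul_max (a := 6 * δ) hp (by positivity) hi hm
        (fun _ => norm_nonneg _) fun x => ?_).trans (by linarith)
      rw [← dist_eq_norm, dist_comm]
      refine (hfT x).2.trans ?_
      nlinarith [two_pow_clog_le x]
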